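/- arXiv:0804.0034 — 2 statements merged into one kernel-verified Lean document; each statement's English description precedes it below -/
import Mathlib

section
/- Let n ≥ 1. There is a constant C = C(n) such that for every measurable g : ℝ^n → ℂ with ‖g‖_X < ∞ and every measurable f : ℝ^n → ℂ with ‖f‖_{B*} < ∞, one has ‖⟨·⟩ g f‖_{L²(ℝ^n)} ≤ C ‖g‖_X ‖f‖_{B*}. In other words, pointwise multiplication by a function of finite X-norm maps the space B* into the weighted space ⟨x⟩^{-1}L²(ℝ^n). -/
open MeasureTheory ENNReal

/-- The dyadic shell `D_j`: `D_0 = {|x| ≤ 1}`, and for `j ≥ 1`,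
`D_j = {2^{j-1} < |x| ≤ 2^j}`. -/
noncomputable def shell (n j : ℕ) : Set (EuclideanSpace ℝ (Fin n)) :=
  if j = 0 then {x | ‖x‖ ≤ 1} else {x | (2 : ℝ) ^ (j - 1) < ‖x‖ ∧ ‖x‖ ≤ (2 : ℝ) ^ j}

/-- `‖g‖_X = (Σ_{j≥0} 2^{3j} ‖g‖_{L^∞(D_j)}²)^{1/2}`. -/
noncomputable def Xnorm {n : ℕ} (g : EuclideanSpace ℝ (Fin n) → ℂ) : ℝ≥0∞ :=
  (∑' j : ℕ, (2 : ℝ≥0∞) ^ (3 * j) *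
    (eLpNorm g ⊤ (volume.restrict (shell n j))) ^ 2) ^ ((1 : ℝ) / 2)

/-- `‖f‖_{B*} = sup_{j≥0} 2^{-j/2} ‖f‖_{L²(D_j)}`. -/
noncomputable def BstarNorm {n : ℕ} (f : EuclideanSpace ℝ (Fin n) → ℂ) : ℝ≥0∞ :=
  ⨆ j : ℕ, (2 : ℝ≥0∞) ^ (-(j : ℝ) / 2) * eLpNorm f 2 (volume.restrict (shell n j))

theorem exists_mem_shell {n : ℕ} (x : EuclideanSpace ℝ (Fin n)) : ∃ j, x ∈ shell n j := by
  classical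
  have hex : ∃ j : ℕ, ‖x‖ ≤ (2 : ℝ) ^ j :=
    (pow_unbounded_of_one_lt ‖x‖ one_lt_two).imp fun _ h => h.le
  refine ⟨Nat.find hex, ?_⟩
  have hle := Nat.find_spec hex
  by_cases h0 : Nat.find hex = 0
  · rw [h0] at hle ⊢
    simpa [shell] using hle
  · simp only [shell, h0, if_false, Set.mem_ofPred_eq]
    exact ⟨not_le.1 (Nat.find_min hex (Nat.sub_one_lt h0)), hle⟩

theorem norm_le_of_mem_shell {n j : ℕ} {x : EuclideanSpace ℝ (Fin n)} (hx : x ∈ shell n j) :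
    ‖x‖ ≤ (2 : ℝ) ^ j := by
  unfold shell at hx
  split_ifs at hx with h
  · simpa [h] using hx
  · exact hx.2

theorem measurableSet_shell (n j : ℕ) : MeasurableSet (shell n j) := by
  unfold shell
  split_ifs
  · exact measurableSet_le measurable_norm measurable_const
  · exact (measurableSet_lt measurable_const measurable_norm).inter
      (measurableSet_le measurable_norm measurable_const)

theorem eLpNorm_two_sq_eq_lintegral {α : Type*} [MeasurableSpace α] (f : α → ℂ) (μ : Measure α) :
    eLpNorm f 2 μ ^ 2 = ∫⁻ x, ‖f x‖ₑ ^ 2 ∂μ := by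
  simpa using eLpNorm_nnreal_pow_eq_lintegral (f := f) (μ := μ) (p := 2) two_ne_zero

theorem enorm_japaneseBracket_sq_le {n j : ℕ} {x : EuclideanSpace ℝ (Fin n)}
    (hx : x ∈ shell n j) :
    ‖(((1 + ‖x‖ ^ 2 : ℝ) ^ ((1 : ℝ) / 2) : ℝ) : ℂ)‖ₑ ^ 2 ≤ 2 ^ (2 * j + 1) := by
  have h0 : (0 : ℝ) ≤ 1 + ‖x‖ ^ 2 := by positivity
  have hle : (1 + ‖x‖ ^ 2 : ℝ) ≤ 2 ^ (2 * j + 1) := by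
    have h1 : ‖x‖ ^ 2 ≤ ((2 : ℝ) ^ j) ^ 2 := by gcongr; exact norm_le_of_mem_shell hx
    have h2 : (1 : ℝ) ≤ ((2 : ℝ) ^ j) ^ 2 := one_le_pow₀ (one_le_pow₀ one_le_two)
    rw [pow_succ (2 : ℝ) (2 * j), Nat.mul_comm, pow_mul]
    linarith
  rw [← Real.sqrt_eq_rpow, ← ofReal_norm, ← ENNReal.ofReal_pow (norm_nonneg _),
    Complex.norm_real, Real.norm_eq_abs, sq_abs, Real.sq_sqrt h0]
  refine (ENNReal.ofReal_le_ofReal hle).trans_eq ?_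
  rw [ENNReal.ofReal_pow zero_le_two, ENNReal.ofReal_ofNat]

theorem eLpNorm_two_shell_sq_le {n : ℕ} (f : EuclideanSpace ℝ (Fin n) → ℂ) (j : ℕ) :
    eLpNorm f 2 (volume.restrict (shell n j)) ^ 2 ≤ 2 ^ j * BstarNorm f ^ 2 := by
  set F := eLpNorm f 2 (volume.restrict (shell n j))
  have h : (2 : ℝ≥0∞) ^ (-(j : ℝ) / 2) * F ≤ BstarNorm f :=
    le_iSup (fun j : ℕ => (2 : ℝ≥0∞) ^ (-(j : ℝ) / 2) *
      eLpNorm f 2 (volume.restrict (shell n j))) j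
  have hF : F = (2 : ℝ≥0∞) ^ ((j : ℝ) / 2) * ((2 : ℝ≥0∞) ^ (-(j : ℝ) / 2) * F) := by
    rw [← mul_assoc, ← ENNReal.rpow_add _ _ two_ne_zero ofNat_ne_top]
    ring_nf
    simp
  have hpow : ((2 : ℝ≥0∞) ^ ((j : ℝ) / 2)) ^ 2 = 2 ^ j := by
    rw [← ENNReal.rpow_natCast, ← ENNReal.rpow_mul, ← ENNReal.rpow_natCast]
    congr 1
    push_cast
    ring
  rw [hF, mul_pow, hpow]
  gcongr

theorem setLIntegral_shell_le {n : ℕ} (g f : EuclideanSpace ℝ (Fin n) → ℂ) (hf : Measurable f)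
    (j : ℕ) :
    ∫⁻ x in shell n j,
        ‖(((1 + ‖x‖ ^ 2 : ℝ) ^ ((1 : ℝ) / 2) : ℝ) : ℂ) * (g x * f x)‖ₑ ^ 2 ≤
      2 ^ (3 * j) * eLpNorm g ⊤ (volume.restrict (shell n j)) ^ 2 * (2 * BstarNorm f ^ 2) := by
  set G := eLpNorm g ⊤ (volume.restrict (shell n j)) with hG
  have hbound : ∀ᵐ x ∂volume.restrict (shell n j), ‖g x‖ₑ ≤ G := by
    rw [hG, eLpNorm_exponent_top]
    exact enorm_ae_le_eLpNormEssSup g _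
  calc
    _ ≤ ∫⁻ x in shell n j, 2 ^ (2 * j + 1) * G ^ 2 * ‖f x‖ₑ ^ 2 := by
      refine lintegral_mono_ae ?_
      filter_upwards [hbound, ae_restrict_mem (measurableSet_shell n j)] with x hg hx
      rw [enorm_mul, enorm_mul, mul_pow, mul_pow, ← mul_assoc]
      exact mul_le_mul' (mul_le_mul' (enorm_japaneseBracket_sq_le hx) (pow_le_pow_left' hg 2)) le_rfl
    _ = 2 ^ (2 * j + 1) * G ^ 2 * eLpNorm f 2 (volume.restrict (shell n j)) ^ 2 := by
      rw [lintegral_const_mul _ (by fun_prop), eLpNorm_two_sq_eq_lintegral]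
    _ ≤ 2 ^ (2 * j + 1) * G ^ 2 * (2 ^ j * BstarNorm f ^ 2) := by
      gcongr
      exact eLpNorm_two_shell_sq_le f j
    _ = _ := by ring

theorem Xnorm_sq {n : ℕ} (g : EuclideanSpace ℝ (Fin n) → ℂ) :
    Xnorm g ^ 2 = ∑' j : ℕ, (2 : ℝ≥0∞) ^ (3 * j) *
      (eLpNorm g ⊤ (volume.restrict (shell n j))) ^ 2 := by
  rw [Xnorm, ← ENNReal.rpow_natCast, ← ENNReal.rpow_mul]
  norm_num

/-- Pointwise multiplication by a function of finite `X`-norm maps `B*` into the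
weighted space `⟨x⟩⁻¹ L²(ℝⁿ)`. -/
theorem mult_X_maps_Bstar_to_weighted_L2 (n : ℕ) (hn : 1 ≤ n) :
    ∃ C : ℝ≥0∞, C ≠ ⊤ ∧
      ∀ g f : EuclideanSpace ℝ (Fin n) → ℂ, Measurable g → Measurable f →
        Xnorm g ≠ ⊤ → BstarNorm f ≠ ⊤ →
        eLpNorm (fun x => (((1 + ‖x‖ ^ 2 : ℝ) ^ ((1 : ℝ) / 2) : ℝ) : ℂ) * (g x * f x))
            2 volume
          ≤ C * Xnorm g * BstarNorm f := by
  refine ⟨2, ofNat_ne_top, fun g f _ hf _ _ => ?_⟩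
  have hcover : (⋃ j, shell n j) = Set.univ :=
    Set.eq_univ_of_forall fun x => Set.mem_iUnion.2 (exists_mem_shell x)
  rw [← ENNReal.pow_le_pow_left_iff two_ne_zero, eLpNorm_two_sq_eq_lintegral,
    ← setLIntegral_univ, ← hcover]
  calc
    _ ≤ ∑' j, ∫⁻ x in shell n j,
        ‖(((1 + ‖x‖ ^ 2 : ℝ) ^ ((1 : ℝ) / 2) : ℝ) : ℂ) * (g x * f x)‖ₑ ^ 2 :=
      lintegral_iUnion_le _ _
    _ ≤ ∑' j, 2 ^ (3 * j) * eLpNorm g ⊤ (volume.restrict (shell n j)) ^ 2 *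
        (2 * BstarNorm f ^ 2) :=
      ENNReal.tsum_le_tsum (setLIntegral_shell_le g f hf)
    _ = 2 * (Xnorm g ^ 2 * BstarNorm f ^ 2) := by
      rw [ENNReal.tsum_mul_right, ← Xnorm_sq]
      ring
    _ ≤ 2 ^ 2 * (Xnorm g ^ 2 * BstarNorm f ^ 2) := by
      gcongr
      norm_num
    _ = _ := by ring
end

section
/- Let n ≥ 1. There is a constant C = C(n) such that for every measurable g : ℝ^n → ℂ with ‖g‖_X < ∞ and every measurable f : ℝ^n → ℂ with ⟨·⟩f ∈ L²(ℝ^n), one has ‖g f‖_B ≤ C ‖g‖_X ‖⟨·⟩ f‖_{L²(ℝ^n)}. In other words, pointwise multiplication by a function of finite X-norm maps the weighted space ⟨x⟩L²(ℝ^n) into B. -/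
open MeasureTheory ENNReal

/-- `‖f‖_B = Σ_{j≥0} 2^{j/2} ‖f‖_{L²(D_j)}`. -/
noncomputable def Bnorm {n : ℕ} (f : EuclideanSpace ℝ (Fin n) → ℂ) : ℝ≥0∞ :=
  ∑' j : ℕ, (2 : ℝ≥0∞) ^ ((j : ℝ) / 2) * eLpNorm f 2 (volume.restrict (shell n j))

theorem pairwise_disjoint_shell (n : ℕ) : Pairwise (Function.onFun Disjoint (shell n)) := by
  refine (pairwise_disjoint_on _).2 fun i j hij => Set.disjoint_left.2 fun x hi hj => ?_
  have hj' : (2 : ℝ) ^ (j - 1) < ‖x‖ := by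
    rw [shell, if_neg (by omega)] at hj
    exact hj.1
  have hi' : ‖x‖ ≤ (2 : ℝ) ^ i := by
    unfold shell at hi
    split_ifs at hi with h
    · simpa [h] using hi
    · exact hi.2
  have : (2 : ℝ) ^ i ≤ 2 ^ (j - 1) := pow_le_pow_right₀ one_le_two (by omega)
  linarith

/-- The Cauchy-Schwarz inequality for series in `ℝ≥0∞`. -/
theorem ENNReal.tsum_mul_le_sqrt_mul_sqrt (a b : ℕ → ℝ≥0∞) :
    ∑' j, a j * b j ≤
      (∑' j, a j ^ 2) ^ ((1 : ℝ) / 2) * (∑' j, b j ^ 2) ^ ((1 : ℝ) / 2) := by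
  have h := ENNReal.lintegral_mul_le_Lp_mul_Lq Measure.count Real.HolderConjugate.two_two
    (measurable_of_countable a).aemeasurable (measurable_of_countable b).aemeasurable
  simpa [lintegral_count] using h

/-- The squared `L²` norms over pairwise disjoint sets add up to at most the total one. -/
theorem tsum_sq_eLpNorm_restrict_le {α E : Type*} [MeasurableSpace α] [NormedAddCommGroup E]
    {μ : Measure α} {s : ℕ → Set α} (hs : ∀ j, MeasurableSet (s j))
    (hd : Pairwise (Function.onFun Disjoint s)) (f : α → E) :
    (∑' j, eLpNorm f 2 (μ.restrict (s j)) ^ 2) ^ ((1 : ℝ) / 2) ≤ eLpNorm f 2 μ := by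
  have hsq (j : ℕ) : eLpNorm f 2 (μ.restrict (s j)) ^ 2 = ∫⁻ x in s j, ‖f x‖ₑ ^ (2 : ℝ) ∂μ := by
    simpa using eLpNorm_nnreal_pow_eq_lintegral (p := 2) (μ := μ.restrict (s j)) (f := f) (by simp)
  simp_rw [hsq]
  rw [← lintegral_iUnion hs hd, eLpNorm_eq_lintegral_rpow_enorm_toReal (by simp) (by simp)]
  simp only [ENNReal.toReal_ofNat]
  gcongr
  exact Measure.restrict_le_self

theorem Bnorm_mul_le {n : ℕ} {g f h : EuclideanSpace ℝ (Fin n) → ℂ} (hf : Measurable f)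
    (hfh : ∀ x, ‖f x‖ ≤ ‖h x‖) :
    Bnorm (fun x => g x * f x) ≤ Xnorm g * eLpNorm h 2 volume := by
  have hpow (j : ℕ) : ((2 : ℝ≥0∞) ^ (3 * (j : ℝ) / 2)) ^ 2 = 2 ^ (3 * j) := by
    rw [← ENNReal.rpow_natCast, ← ENNReal.rpow_mul, ← ENNReal.rpow_natCast]
    congr 1
    push_cast
    ring
  calc Bnorm (fun x => g x * f x)
      ≤ ∑' j : ℕ, ((2 : ℝ≥0∞) ^ (3 * (j : ℝ) / 2) *
          eLpNorm g ⊤ (volume.restrict (shell n j))) *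
            eLpNorm h 2 (volume.restrict (shell n j)) := by
        refine ENNReal.tsum_le_tsum fun j => ?_
        rw [mul_assoc]
        have hj : (0 : ℝ) ≤ j := j.cast_nonneg
        refine mul_le_mul' (ENNReal.rpow_le_rpow_of_exponent_le (by norm_num) (by linarith)) ?_
        exact (eLpNorm_smul_le_eLpNorm_top_mul_eLpNorm 2 hf.aestronglyMeasurable g).trans
          (mul_le_mul_right (eLpNorm_mono hfh) _)
    _ ≤ _ := ENNReal.tsum_mul_le_sqrt_mul_sqrt _ _
    _ ≤ Xnorm g * eLpNorm h 2 volume := by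
        simp_rw [mul_pow, hpow]
        exact mul_le_mul_right
          (tsum_sq_eLpNorm_restrict_le (measurableSet_shell n) (pairwise_disjoint_shell n) h) _

/-- Pointwise multiplication by a function of finite `X`-norm maps the weighted
space `⟨x⟩ L²(ℝⁿ)` into `B`. -/
theorem mult_X_maps_weighted_L2_to_B (n : ℕ) (hn : 1 ≤ n) :
    ∃ C : ℝ≥0∞, C ≠ ⊤ ∧
      ∀ g f : EuclideanSpace ℝ (Fin n) → ℂ, Measurable g → Measurable f →
        Xnorm g ≠ ⊤ →
        eLpNorm (fun x => (((1 + ‖x‖ ^ 2 : ℝ) ^ ((1 : ℝ) / 2) : ℝ) : ℂ) * f x)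
            2 volume ≠ ⊤ →
        Bnorm (fun x => g x * f x)
          ≤ C * Xnorm g *
            eLpNorm (fun x => (((1 + ‖x‖ ^ 2 : ℝ) ^ ((1 : ℝ) / 2) : ℝ) : ℂ) * f x)
              2 volume := by
  refine ⟨1, ENNReal.one_ne_top, fun g f _ hf _ _ => ?_⟩
  rw [one_mul]
  refine Bnorm_mul_le hf fun x => ?_
  have hx : (1 : ℝ) ≤ (1 + ‖x‖ ^ 2) ^ ((1 : ℝ) / 2) :=
    Real.one_le_rpow (by nlinarith [sq_nonneg ‖x‖]) (by norm_num)
  rw [norm_mul, Complex.norm_real, Real.norm_of_nonneg (by linarith)]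
  exact le_mul_of_one_le_left (norm_nonneg _) hx
end
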